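/- For any positive integer k and any commutative monoid M, the monoid semiring S_k[M] (the monoid algebra of M over the Indigenous semiring S_k, consisting of finitely supported functions M → S_k with convolution product) is an information algebra: it has no zero divisors and is zerosumfree. -/

import Mathlib

/-- The ring congruence on ℕ identifying all numbers greater than `k`. -/
def indCon (k : ℕ) : RingCon ℕ where
  r a b := a = b ∨ (k < a ∧ k < b)
  iseqv := by
    refine ⟨fun _ => Or.inl rfl, ?_, ?_⟩
    · rintro a b (rfl | ⟨h1, h2⟩)
      · exact Or.inl rfl
      · exact Or.inr ⟨h2, h1⟩
    · rintro a b c (rfl | ⟨h1, h2⟩) (rfl | ⟨h3, h4⟩)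
      · exact Or.inl rfl
      · exact Or.inr ⟨h3, h4⟩
      · exact Or.inr ⟨h1, h2⟩
      · exact Or.inr ⟨h1, h4⟩
  add' := by
    rintro a b c d (rfl | ⟨ha, hb⟩) (rfl | ⟨hc, hd⟩)
    · exact Or.inl rfl
    · exact Or.inr ⟨by omega, by omega⟩
    · exact Or.inr ⟨by omega, by omega⟩
    · exact Or.inr ⟨by omega, by omega⟩
  mul' := by
    rintro a b c d (rfl | ⟨ha, hb⟩) (rfl | ⟨hc, hd⟩)
    · exact Or.inl rfl
    · rcases Nat.eq_zero_or_pos a with rfl | ha0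
      · simp
      · exact Or.inr ⟨lt_of_lt_of_le hc (Nat.le_mul_of_pos_left c ha0),
          lt_of_lt_of_le hd (Nat.le_mul_of_pos_left d ha0)⟩
    · rcases Nat.eq_zero_or_pos c with rfl | hc0
      · simp
      · exact Or.inr ⟨lt_of_lt_of_le ha (Nat.le_mul_of_pos_right a hc0),
          lt_of_lt_of_le hb (Nat.le_mul_of_pos_right b hc0)⟩
    · exact Or.inr ⟨lt_of_lt_of_le ha (Nat.le_mul_of_pos_right a (by omega)),
        lt_of_lt_of_le hb (Nat.le_mul_of_pos_right b (by omega))⟩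

/-- The Indigenous semiring `S_k = {0, 1, ..., k} ∪ {m}`, realized as the quotient of ℕ
by the congruence identifying all numbers greater than `k`. -/
abbrev IndSemiring (k : ℕ) : Type := (indCon k).Quotient

/-- The element `m` ("many") of the Indigenous semiring. -/
def indM (k : ℕ) : IndSemiring k := (indCon k).mk' (k + 1)


namespace MonoidAlgebra

variable {R M : Type*} [Semiring R]

/-- A monoid semiring over a zerosumfree semiring is zerosumfree. -/
instance instSubsingletonAddUnits [Subsingleton (AddUnits R)] :
    Subsingleton (AddUnits (MonoidAlgebra R M)) :=
  subsingleton_of_forall_eq 0 fun u => AddUnits.ext <| by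
    ext m
    have h : (u : MonoidAlgebra R M).coeff m + (↑(-u) : MonoidAlgebra R M).coeff m = 0 := by
      rw [← Finsupp.add_apply, ← coeff_add, AddUnits.add_neg, coeff_zero, Finsupp.zero_apply]
    exact (add_eq_zero.mp h).1

/-- A monoid semiring over an information algebra has no zero divisors. -/
theorem noZeroDivisors_of_subsingleton_addUnits [Mul M] [Subsingleton (AddUnits R)]
    [NoZeroDivisors R] : NoZeroDivisors (MonoidAlgebra R M) where
  eq_zero_or_eq_zero_of_mul_eq_zero {f g} hfg := by
    by_contra! h
    obtain ⟨a, ha⟩ := Finsupp.ne_iff.mp (coeff_eq_zero.not.mpr h.1)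
    obtain ⟨b, hb⟩ := Finsupp.ne_iff.mp (coeff_eq_zero.not.mpr h.2)
    rw [mul_def] at hfg
    have hab := Finset.sum_eq_zero_iff.mp
      (Finset.sum_eq_zero_iff.mp hfg a (Finsupp.mem_support_iff.mpr ha))
      b (Finsupp.mem_support_iff.mpr hb)
    exact mul_ne_zero ha hb (single_eq_zero.mp hab)

end MonoidAlgebra

namespace IndSemiring

theorem natCast_eq_zero {k n : ℕ} : ((n : ℕ) : IndSemiring k) = 0 ↔ n = 0 := by
  refine ⟨fun h => ?_, by rintro rfl; exact Nat.cast_zero⟩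
  rcases (RingCon.eq (indCon k) (a := n) (b := 0)).mp h with h | ⟨-, h⟩
  · exact h
  · exact absurd h (Nat.not_lt_zero k)

theorem natCast_surjective (k : ℕ) : Function.Surjective (Nat.cast : ℕ → IndSemiring k) :=
  Quotient.mk_surjective

instance (k : ℕ) : NoZeroDivisors (IndSemiring k) where
  eq_zero_or_eq_zero_of_mul_eq_zero {x y} h := by
    obtain ⟨a, rfl⟩ := natCast_surjective k x
    obtain ⟨b, rfl⟩ := natCast_surjective k y
    rw [← Nat.cast_mul, natCast_eq_zero] at h
    simpa only [natCast_eq_zero] using mul_eq_zero.mp h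

instance (k : ℕ) : Subsingleton (AddUnits (IndSemiring k)) :=
  subsingleton_of_forall_eq 0 fun u => AddUnits.ext <| by
    obtain ⟨a, ha⟩ := natCast_surjective k u
    obtain ⟨b, hb⟩ := natCast_surjective k ↑(-u)
    have h := u.add_neg
    rw [← ha, ← hb, ← Nat.cast_add, natCast_eq_zero] at h
    rw [← ha, AddUnits.val_zero, natCast_eq_zero]
    exact (add_eq_zero.mp h).1

end IndSemiring

/-- For any positive integer `k` and any commutative monoid `M`, the monoid semiring
`S_k[M]` is an information algebra: no zero divisors and zerosumfree. -/
theorem monoidAlgebra_indSemiring_information_algebra (k : ℕ) (hk : 0 < k)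
    (M : Type*) [CommMonoid M] :
    (∀ f g : MonoidAlgebra (IndSemiring k) M, f * g = 0 → f = 0 ∨ g = 0) ∧
    (∀ f g : MonoidAlgebra (IndSemiring k) M, f + g = 0 → f = 0 ∧ g = 0) := by
  have := MonoidAlgebra.noZeroDivisors_of_subsingleton_addUnits (R := IndSemiring k) (M := M)
  exact ⟨fun _ _ => mul_eq_zero.mp, fun _ _ => add_eq_zero.mp⟩
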